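/- Let {u₁, …, u_k} be a generating set of the monoid S. Then the collection of all semistable loci satisfies {X^{ss}(u) : u ∈ S} = {⋂_{i ∈ I} X^{ss}(uᵢ) : I ⊆ {1, …, k}}; in particular, the set of subsets of Spec A arising as semistable loci X^{ss}(u) for u ∈ S is finite. -/

import Mathlib

open scoped BigOperators

/-- The character `χ^s` in the monoid algebra `ℂ[S]`. -/
noncomputable def chi {n : ℕ} (S : AddSubmonoid (Fin n → ℤ)) (s : S) :
    AddMonoidAlgebra ℂ S :=
  AddMonoidAlgebra.single s 1

/-- The homogeneous component of degree `m ∈ M = ℤ^n` of the `M`-graded algebra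
`A = ℂ[S]`: it is `ℂ · χ^m` if `m ∈ S` and `0` otherwise. -/
noncomputable def homComponent {n : ℕ} (S : AddSubmonoid (Fin n → ℤ)) (m : Fin n → ℤ) :
    Submodule ℂ (AddMonoidAlgebra ℂ S) :=
  Submodule.span ℂ {f | ∃ s : S, (s : Fin n → ℤ) = m ∧ f = chi S s}

/-- The semistable locus `X^{ss}(u) ⊆ Spec A`: the union of the basic open sets `D(f)`
over all integers `k > 0` and all `f` in the component of degree `k • u`. -/
noncomputable def ssLocus {n : ℕ} (S : AddSubmonoid (Fin n → ℤ)) (u : Fin n → ℤ) :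
    Set (PrimeSpectrum (AddMonoidAlgebra ℂ S)) :=
  ⋃ (k : ℕ) (_ : 0 < k) (f ∈ homComponent S (k • u)), {p | f ∉ p.asIdeal}


theorem chi_add_aux {n : ℕ} (S : AddSubmonoid (Fin n → ℤ)) (a b : S) :
    chi S (a + b) = chi S a * chi S b := by
  simp [chi, AddMonoidAlgebra.single_mul_single]

theorem chi_zero_aux {n : ℕ} (S : AddSubmonoid (Fin n → ℤ)) : chi S 0 = 1 := rfl

theorem chi_nsmul_aux {n : ℕ} (S : AddSubmonoid (Fin n → ℤ)) (k : ℕ) (a : S) :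
    chi S (k • a) = chi S a ^ k := by
  induction k with
  | zero => simp [chi_zero_aux]
  | succ k ih => rw [succ_nsmul, chi_add_aux, ih, pow_succ]

theorem mem_ssLocus_aux {n : ℕ} (S : AddSubmonoid (Fin n → ℤ)) (u : S)
    (p : PrimeSpectrum (AddMonoidAlgebra ℂ S)) :
    p ∈ ssLocus S (u : Fin n → ℤ) ↔ chi S u ∉ p.asIdeal := by
  simp only [ssLocus, Set.mem_iUnion, Set.mem_ofPred_eq, exists_prop]
  constructor
  · rintro ⟨k, hk, f, hf, hfp⟩ hu
    apply hfp
    have hle : homComponent S (k • (u : Fin n → ℤ)) ≤ p.asIdeal.restrictScalars ℂ := by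
      refine Submodule.span_le.2 ?_
      rintro g ⟨s, hs, rfl⟩
      have h : s = k • u := Subtype.ext (by simpa using hs)
      subst h
      change chi S (k • u) ∈ p.asIdeal
      rw [chi_nsmul_aux]
      exact Ideal.pow_mem_of_mem _ hu k hk
    exact hle hf
  · intro h
    exact ⟨1, one_pos, chi S u, Submodule.subset_span ⟨u, by simp, rfl⟩, h⟩

theorem ssLocus_zero_aux {n : ℕ} (S : AddSubmonoid (Fin n → ℤ)) :
    ssLocus S ((0 : S) : Fin n → ℤ) = Set.univ := by
  ext p
  rw [mem_ssLocus_aux, chi_zero_aux]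
  simpa using (Ideal.ne_top_iff_one _).1 p.isPrime.ne_top

theorem ssLocus_add_aux {n : ℕ} (S : AddSubmonoid (Fin n → ℤ)) (a b : S) :
    ssLocus S ((a + b : S) : Fin n → ℤ) = ssLocus S (a : Fin n → ℤ) ∩ ssLocus S (b : Fin n → ℤ) := by
  ext p
  rw [Set.mem_inter_iff, mem_ssLocus_aux, mem_ssLocus_aux, mem_ssLocus_aux, chi_add_aux,
    p.isPrime.mul_mem_iff_mem_or_mem, not_or]

theorem ssLocus_sum_aux {n k : ℕ} (S : AddSubmonoid (Fin n → ℤ)) (U : Fin k → S)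
    (I : Finset (Fin k)) :
    ssLocus S ((∑ i ∈ I, U i : S) : Fin n → ℤ) = ⋂ i ∈ I, ssLocus S (U i : Fin n → ℤ) := by
  classical
  induction I using Finset.induction_on with
  | empty => rw [Finset.sum_empty, ssLocus_zero_aux]; simp
  | insert a s ha ih => rw [Finset.sum_insert ha, ssLocus_add_aux, ih, Finset.set_biInter_insert]

/-- If `{u₁, …, u_k}` generates the monoid `S`, then the collection of semistable loci
`{X^{ss}(u) : u ∈ S}` coincides with the collection of finite intersections
`⋂_{i ∈ I} X^{ss}(uᵢ)` for `I ⊆ {1, …, k}`; in particular it is a finite collection. -/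
theorem semistable_collection_finite {n : ℕ} (C : Set (Fin n → ℚ))
    (hpoly : ∃ (k : ℕ) (g : Fin k → (Fin n → ℚ)),
      C = {x | ∃ c : Fin k → ℚ, (∀ i, 0 ≤ c i) ∧ x = ∑ i, c i • g i})
    (hfull : Submodule.span ℚ C = ⊤)
    (S : AddSubmonoid (Fin n → ℤ))
    (hS : (S : Set (Fin n → ℤ)) = {u : Fin n → ℤ | (fun i => (u i : ℚ)) ∈ C})
    (k : ℕ) (U : Fin k → S)
    (hgen : AddSubmonoid.closure (Set.range fun i => (U i : Fin n → ℤ)) = S) :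
    {A : Set (PrimeSpectrum (AddMonoidAlgebra ℂ S)) | ∃ u : S, A = ssLocus S (u : Fin n → ℤ)} =
      {A | ∃ I : Finset (Fin k), A = ⋂ i ∈ I, ssLocus S (U i : Fin n → ℤ)} ∧
    {A : Set (PrimeSpectrum (AddMonoidAlgebra ℂ S)) |
      ∃ u : S, A = ssLocus S (u : Fin n → ℤ)}.Finite := by
  classical
  have key : ∀ u (hu : u ∈ AddSubmonoid.closure (Set.range fun i => (U i : Fin n → ℤ))),
      ∃ I : Finset (Fin k), ssLocus S u = ⋂ i ∈ I, ssLocus S (U i : Fin n → ℤ) := by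
    intro u hu
    induction hu using AddSubmonoid.closure_induction with
    | mem x hx =>
      obtain ⟨i, rfl⟩ := hx
      exact ⟨{i}, by simp⟩
    | zero => exact ⟨∅, by simpa using ssLocus_zero_aux S⟩
    | add x y hx hy ihx ihy =>
      obtain ⟨I, hI⟩ := ihx
      obtain ⟨J, hJ⟩ := ihy
      rw [hgen] at hx hy
      refine ⟨I ∪ J, ?_⟩
      have h := ssLocus_add_aux S ⟨x, hx⟩ ⟨y, hy⟩
      have e : (⋂ i ∈ I ∪ J, ssLocus S (U i : Fin n → ℤ)) =
          (⋂ i ∈ I, ssLocus S (U i : Fin n → ℤ)) ∩ ⋂ i ∈ J, ssLocus S (U i : Fin n → ℤ) := by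
        ext p
        simp only [Set.mem_iInter, Set.mem_inter_iff, Finset.mem_union, or_imp, forall_and]
      rw [e, ← hI, ← hJ]
      exact h
  have main : {A : Set (PrimeSpectrum (AddMonoidAlgebra ℂ S)) |
        ∃ u : S, A = ssLocus S (u : Fin n → ℤ)} =
      {A | ∃ I : Finset (Fin k), A = ⋂ i ∈ I, ssLocus S (U i : Fin n → ℤ)} := by
    ext A
    constructor
    · rintro ⟨u, rfl⟩
      exact key u (by rw [hgen]; exact u.2)
    · rintro ⟨I, rfl⟩
      exact ⟨∑ i ∈ I, U i, (ssLocus_sum_aux S U I).symm⟩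
  refine ⟨main, ?_⟩
  rw [main]
  refine (Set.finite_range
    (fun I : Finset (Fin k) => ⋂ i ∈ I, ssLocus S (U i : Fin n → ℤ))).subset ?_
  rintro A ⟨I, rfl⟩
  exact ⟨I, rfl⟩
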